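/- Let ρ(s) := (1/2π)√(4 − s²) for s ∈ [−2,2] and ρ(s) := 0 otherwise. Then ρ is a probability density (∫_{−2}^{2} ρ(s) ds = 1), and there exists a real constant l such that 2∫_{−2}^{2} log|y − s| ρ(s) ds − y²/2 = l for every y ∈ [−2,2], while 2∫_{−2}^{2} log|y − s| ρ(s) ds − y²/2 < l for every y ∈ ℝ \ [−2,2]. -/

import Mathlib

open MeasureTheory Real

/-- The semicircle (equilibrium-measure) density on `[-2,2]` for the potential `y²/2`. -/
noncomputable def rho (s : ℝ) : ℝ :=
  if s ∈ Set.Icc (-2 : ℝ) 2 then (1 / (2 * π)) * Real.sqrt (4 - s ^ 2) else 0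

/-- The Fourier coefficient of `log ‖1 - a z‖` on the unit circle against `cos 2θ`. -/
lemma integral_log_norm_one_sub_mul_cos {a : ℂ} (ha : ‖a‖ < 1) :
    ∫ θ in (0 : ℝ)..2 * π, log ‖1 - a * circleMap 0 1 θ‖ * cos (2 * θ) =
      -(π / 2) * (a ^ 2).re := by
  set L : ℂ → ℂ := fun z ↦ Complex.log (1 - a * z) with hL
  have hnorm : ∀ z ∈ Metric.closedBall (0 : ℂ) 1, ‖a * z‖ < 1 := fun z hz ↦ by
    rw [mem_closedBall_zero_iff] at hz
    rw [norm_mul]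
    nlinarith [norm_nonneg a, norm_nonneg z]
  have hslit : ∀ z ∈ Metric.closedBall (0 : ℂ) 1, 1 - a * z ∈ Complex.slitPlane := fun z hz ↦ by
    left
    have := (Complex.re_le_norm (a * z)).trans_lt (hnorm z hz)
    simpa using this
  have hderiv : ∀ z ∈ Metric.closedBall (0 : ℂ) 1, HasDerivAt L (-a / (1 - a * z)) z :=
    fun z hz ↦ by
    have h : HasDerivAt (fun z : ℂ ↦ 1 - a * z) (-a) z := by
      simpa using ((hasDerivAt_id z).const_mul a).const_sub 1
    exact h.clog (hslit z hz)
  have hdiff : DifferentiableOn ℂ L (Metric.closedBall 0 1) := fun z hz ↦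
    (hderiv z hz).differentiableAt.differentiableWithinAt
  have hiter : iteratedDeriv 2 L 0 = -a ^ 2 := by
    rw [iteratedDeriv_succ, iteratedDeriv_one]
    have hev : deriv L =ᶠ[nhds 0] fun z ↦ -a / (1 - a * z) := by
      filter_upwards [Metric.closedBall_mem_nhds (0 : ℂ) one_pos] with z hz
      exact (hderiv z hz).deriv
    rw [hev.deriv_eq]
    have h : HasDerivAt (fun z : ℂ ↦ 1 - a * z) (-a) 0 := by
      simpa using ((hasDerivAt_id (0 : ℂ)).const_mul a).const_sub 1
    have h2 := (hasDerivAt_const (0 : ℂ) (-a)).div h (by simp)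
    refine h2.deriv.trans ?_
    simp
    ring
  have hmem : ∀ θ : ℝ, circleMap 0 1 θ ∈ Metric.closedBall (0 : ℂ) 1 := fun θ ↦
    circleMap_mem_closedBall 0 zero_le_one θ
  have hcont : Continuous fun θ : ℝ ↦ L (circleMap 0 1 θ) :=
    hdiff.continuousOn.comp_continuous (continuous_circleMap 0 1) hmem
  have hne : ∀ θ : ℝ, circleMap 0 1 θ ≠ 0 := fun θ ↦ circleMap_ne_center one_ne_zero
  have hpos : ∫ θ in (0 : ℝ)..2 * π, circleMap 0 1 θ ^ 2 * L (circleMap 0 1 θ) = 0 := by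
    have h : ∮ z in C(0, 1), z * L z = 0 :=
      ((differentiableOn_id.mul hdiff).mono
        Metric.closure_ball_subset_closedBall).diffContOnCl.circleIntegral_eq_zero zero_le_one
    simp only [circleIntegral, deriv_circleMap, smul_eq_mul] at h
    have h' : ∫ θ in (0 : ℝ)..2 * π,
        Complex.I * (circleMap 0 1 θ ^ 2 * L (circleMap 0 1 θ)) = 0 := by
      refine Eq.trans ?_ h
      exact intervalIntegral.integral_congr fun θ _ ↦ by ring
    rw [intervalIntegral.integral_const_mul] at h'
    exact (mul_eq_zero.mp h').resolve_left Complex.I_ne_zero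
  have hneg : ∫ θ in (0 : ℝ)..2 * π, (circleMap 0 1 θ ^ 2)⁻¹ * L (circleMap 0 1 θ) =
      -π * a ^ 2 := by
    have h := hdiff.circleIntegral_one_div_sub_center_pow_smul one_pos 2
    simp only [circleIntegral, deriv_circleMap, smul_eq_mul, hiter, sub_zero] at h
    have h' : ∫ θ in (0 : ℝ)..2 * π,
        Complex.I * ((circleMap 0 1 θ ^ 2)⁻¹ * L (circleMap 0 1 θ)) =
          Complex.I * (-π * a ^ 2) := by
      convert h using 1
      · refine intervalIntegral.integral_congr fun θ _ ↦ ?_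
        have := hne θ
        field_simp
        ring
      · simp [Nat.factorial]; ring
    rw [intervalIntegral.integral_const_mul] at h'
    exact mul_left_cancel₀ Complex.I_ne_zero h'
  have hcos : ∀ θ : ℝ, ((2 * cos (2 * θ) : ℝ) : ℂ) =
      circleMap 0 1 θ ^ 2 + (circleMap 0 1 θ ^ 2)⁻¹ := fun θ ↦ by
    rw [circleMap, zero_add, Complex.ofReal_one, one_mul, ← Complex.exp_nat_mul, ← Complex.exp_neg]
    push_cast
    rw [Complex.two_cos]
    congr 2 <;> ring
  have hsum : ∫ θ in (0 : ℝ)..2 * π, ((2 * cos (2 * θ) : ℝ) : ℂ) * L (circleMap 0 1 θ) =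
      -π * a ^ 2 := by
    have hc : Continuous fun θ : ℝ ↦ circleMap 0 1 θ := continuous_circleMap 0 1
    have h := intervalIntegral.integral_add (μ := volume)
      (((hc.pow 2).mul hcont).intervalIntegrable 0 (2 * π))
      ((((hc.pow 2).inv₀ fun θ ↦ pow_ne_zero 2 (hne θ)).mul hcont).intervalIntegrable 0 (2 * π))
    simp only [Pi.mul_apply, Pi.pow_apply, Pi.inv_apply] at h
    rw [hpos, hneg, zero_add] at h
    simpa only [hcos, add_mul] using h
  have hre := Complex.reCLM.intervalIntegral_comp_comm (μ := volume) (a := 0) (b := 2 * π)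
    (f := fun θ : ℝ ↦ ((2 * cos (2 * θ) : ℝ) : ℂ) * L (circleMap 0 1 θ))
    (Continuous.intervalIntegrable (Continuous.mul (by fun_prop) hcont) _ _)
  rw [hsum] at hre
  simp only [Complex.reCLM_apply, Complex.re_ofReal_mul, hL, Complex.log_re] at hre
  have hrw : ∀ θ : ℝ, 2 * cos (2 * θ) * log ‖1 - a * circleMap 0 1 θ‖ =
      2 * (log ‖1 - a * circleMap 0 1 θ‖ * cos (2 * θ)) := fun θ ↦ by ring
  simp only [hrw, intervalIntegral.integral_const_mul] at hre
  rw [← Complex.ofReal_neg, Complex.re_ofReal_mul] at hre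
  linarith

lemma intervalIntegrable_log_norm_circleMap_sub (w : ℂ) (a b : ℝ) :
    IntervalIntegrable (fun θ : ℝ ↦ log ‖circleMap 0 1 θ - w‖) volume a b := by
  have hper : Function.Periodic (fun θ : ℝ ↦ log ‖circleMap 0 1 θ - w‖) (2 * π) := fun θ ↦ by
    simp [periodic_circleMap 0 1 θ]
  exact hper.intervalIntegrable₀ two_pi_pos.ne'
    (circleIntegrable_log_norm_sub_const (a := w) (c := 0) 1) a b

lemma integral_log_norm_circleMap_sub_mul_sin_sq_of_one_lt {w : ℂ} (hw : 1 < ‖w‖) :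
    ∫ θ in (0 : ℝ)..2 * π, log ‖circleMap 0 1 θ - w‖ * sin θ ^ 2 =
      π * log ‖w‖ + π / 4 * ((w ^ 2)⁻¹).re := by
  have hw0 : w ≠ 0 := norm_pos_iff.mp (one_pos.trans hw)
  have hinv : ‖w⁻¹‖ < 1 := by rw [norm_inv]; exact inv_lt_one_of_one_lt₀ hw
  have havg := circleAverage_log_norm_sub_const₂ hw
  rw [circleAverage, smul_eq_mul, inv_mul_eq_iff_eq_mul₀ two_pi_pos.ne'] at havg
  have hcoef := integral_log_norm_one_sub_mul_cos hinv
  have hne : ∀ θ : ℝ, 1 - w⁻¹ * circleMap 0 1 θ ≠ 0 := fun θ h ↦ by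
    have h1 : ‖w⁻¹ * circleMap 0 1 θ‖ = 1 := by rw [← sub_eq_zero.mp h, norm_one]
    rw [norm_mul, norm_circleMap_zero, abs_one, mul_one] at h1
    exact hinv.ne h1
  have hlog : ∀ θ : ℝ, log ‖circleMap 0 1 θ - w‖ =
      log ‖w‖ + log ‖1 - w⁻¹ * circleMap 0 1 θ‖ := fun θ ↦ by
    rw [← log_mul (norm_ne_zero_iff.mpr hw0) (norm_ne_zero_iff.mpr (hne θ)), ← norm_mul,
      norm_sub_rev]
    congr 2
    field_simp
  have hrw : ∀ θ : ℝ, log ‖circleMap 0 1 θ - w‖ * sin θ ^ 2 =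
      1 / 2 * log ‖circleMap 0 1 θ - w‖ - log ‖w‖ / 2 * cos (2 * θ)
        - 1 / 2 * (log ‖1 - w⁻¹ * circleMap 0 1 θ‖ * cos (2 * θ)) := fun θ ↦ by
    rw [sin_sq_eq_half_sub, hlog]
    ring
  have hcos : ∫ θ in (0 : ℝ)..2 * π, cos (2 * θ) = 0 := by
    rw [intervalIntegral.integral_comp_mul_left _ two_ne_zero, integral_cos]
    have : sin (2 * (2 * π)) = 0 := by simpa [← mul_assoc, show (2 * 2 : ℝ) = 4 by norm_num] using sin_nat_mul_pi 4
    simp [this]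
  have hc : Continuous fun θ : ℝ ↦ log ‖1 - w⁻¹ * circleMap 0 1 θ‖ :=
    Continuous.log (by have := continuous_circleMap 0 1; fun_prop)
      fun θ ↦ norm_ne_zero_iff.mpr (hne θ)
  have i1 := (intervalIntegrable_log_norm_circleMap_sub w 0 (2 * π)).const_mul (1 / 2)
  have i2 : IntervalIntegrable (fun θ : ℝ ↦ log ‖w‖ / 2 * cos (2 * θ)) volume 0 (2 * π) :=
    Continuous.intervalIntegrable (by fun_prop) _ _
  have i3 : IntervalIntegrable
      (fun θ : ℝ ↦ 1 / 2 * (log ‖1 - w⁻¹ * circleMap 0 1 θ‖ * cos (2 * θ))) volume 0 (2 * π) :=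
    Continuous.intervalIntegrable (by fun_prop) _ _
  simp only [hrw]
  rw [intervalIntegral.integral_sub (i1.sub i2) i3, intervalIntegral.integral_sub i1 i2]
  simp only [intervalIntegral.integral_const_mul, hcos, hcoef, havg, inv_pow]
  ring

lemma norm_sub_le_norm_sub_mul {z w : ℂ} (hz : ‖z‖ = 1) (hw : ‖w‖ = 1) {r : ℝ} (hr : 1 ≤ r) :
    ‖z - w‖ ≤ ‖z - r * w‖ := by
  rw [← sq_le_sq₀ (norm_nonneg _) (norm_nonneg _)]
  have hz' : z.re * z.re + z.im * z.im = 1 := by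
    rw [← Complex.normSq_apply, Complex.normSq_eq_norm_sq, hz, one_pow]
  have hw' : w.re * w.re + w.im * w.im = 1 := by
    rw [← Complex.normSq_apply, Complex.normSq_eq_norm_sq, hw, one_pow]
  simp only [← Complex.normSq_eq_norm_sq, Complex.normSq_apply, Complex.sub_re, Complex.sub_im,
    Complex.re_ofReal_mul, Complex.im_ofReal_mul]
  have hc : z.re * w.re + z.im * w.im ≤ 1 := by
    nlinarith [sq_nonneg (z.re - w.re), sq_nonneg (z.im - w.im)]
  have hd : 0 ≤ (r - 1) * (r + 1 - 2 * (z.re * w.re + z.im * w.im)) :=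
    mul_nonneg (by linarith) (by linarith)
  linear_combination hd + (1 - r ^ 2) * hw'

lemma integral_log_norm_circleMap_sub_mul_sin_sq {w : ℂ} (hw : 1 ≤ ‖w‖) :
    ∫ θ in (0 : ℝ)..2 * π, log ‖circleMap 0 1 θ - w‖ * sin θ ^ 2 =
      π * log ‖w‖ + π / 4 * ((w ^ 2)⁻¹).re := by
  rcases hw.lt_or_eq with hw | hw
  · exact integral_log_norm_circleMap_sub_mul_sin_sq_of_one_lt hw
  have hw0 : w ≠ 0 := norm_pos_iff.mp (by rw [← hw]; exact one_pos)
  have hae : ∀ᵐ θ : ℝ, circleMap 0 1 θ ≠ w :=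
    compl_mem_ae_iff.mpr
      (((Set.countable_singleton w).preimage_circleMap 0 one_ne_zero).measure_zero volume)
  have hball : ∀ᶠ r : ℝ in nhdsWithin 1 (Set.Ioi 1), 1 < r ∧ r < 3 := by
    filter_upwards [Ioo_mem_nhdsGT (show (1 : ℝ) < 3 by norm_num)] with r hr using hr
  have hlim : Filter.Tendsto
      (fun r : ℝ ↦ ∫ θ in (0 : ℝ)..2 * π, log ‖circleMap 0 1 θ - r * w‖ * sin θ ^ 2)
      (nhdsWithin 1 (Set.Ioi 1))
      (nhds (∫ θ in (0 : ℝ)..2 * π, log ‖circleMap 0 1 θ - w‖ * sin θ ^ 2)) := by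
    refine intervalIntegral.tendsto_integral_filter_of_dominated_convergence
      (fun θ ↦ |log ‖circleMap 0 1 θ - w‖| + log 4) ?_ ?_ ?_ ?_
    · refine .of_forall fun r ↦ Measurable.aestronglyMeasurable ?_
      have := (continuous_circleMap 0 1).measurable
      fun_prop
    · filter_upwards [hball] with r hr
      filter_upwards [hae] with θ hθ _
      have hz : ‖circleMap 0 1 θ‖ = 1 := by simp
      have hpos : 0 < ‖circleMap 0 1 θ - w‖ := norm_pos_iff.mpr (sub_ne_zero.mpr hθ)
      have hle := norm_sub_le_norm_sub_mul hz hw.symm hr.1.le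
      have hub : ‖circleMap 0 1 θ - r * w‖ ≤ 4 := by
        refine (norm_sub_le _ _).trans ?_
        rw [norm_mul, hz, ← hw, Complex.norm_real, norm_eq_abs, abs_of_pos (by linarith)]
        linarith
      have h1 := log_le_log hpos hle
      have h2 := log_le_log (hpos.trans_le hle) hub
      have h3 : |log ‖circleMap 0 1 θ - r * w‖| ≤ |log ‖circleMap 0 1 θ - w‖| + log 4 := by
        have := log_pos (show (1 : ℝ) < 4 by norm_num)
        rw [abs_le]
        constructor <;>
          linarith [neg_abs_le (log ‖circleMap 0 1 θ - w‖), abs_nonneg (log ‖circleMap 0 1 θ - w‖)]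
      rw [norm_mul, norm_eq_abs, norm_eq_abs, abs_of_nonneg (sq_nonneg (sin θ))]
      exact (mul_le_of_le_one_right (abs_nonneg _) (sin_sq_le_one θ)).trans h3
    · exact (intervalIntegrable_log_norm_circleMap_sub w 0 (2 * π)).abs.add
        intervalIntegrable_const
    · filter_upwards [hae] with θ hθ _
      have hne : ‖circleMap 0 1 θ - (1 : ℝ) * w‖ ≠ 0 := by
        simpa [sub_eq_zero] using hθ
      have hc : ContinuousAt
          (fun r : ℝ ↦ log ‖circleMap 0 1 θ - r * w‖ * sin θ ^ 2) 1 :=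
        (ContinuousAt.log (f := fun r : ℝ ↦ ‖circleMap 0 1 θ - r * w‖) (by fun_prop) hne).mul
          continuousAt_const
      simpa [ContinuousAt] using hc.tendsto.mono_left nhdsWithin_le_nhds
  have hlim' : Filter.Tendsto
      (fun r : ℝ ↦ π * log ‖(r : ℂ) * w‖ + π / 4 * ((((r : ℂ) * w) ^ 2)⁻¹).re)
      (nhdsWithin 1 (Set.Ioi 1)) (nhds (π * log ‖w‖ + π / 4 * ((w ^ 2)⁻¹).re)) := by
    have hc : ContinuousAt
        (fun r : ℝ ↦ π * log ‖(r : ℂ) * w‖ + π / 4 * ((((r : ℂ) * w) ^ 2)⁻¹).re) 1 := by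
      refine (continuousAt_const.mul (ContinuousAt.log (by fun_prop) (by simpa using hw0))).add
        (continuousAt_const.mul (Complex.continuous_re.continuousAt.comp
          (ContinuousAt.inv₀ (by fun_prop) (by simpa using hw0))))
    simpa [ContinuousAt] using hc.tendsto.mono_left nhdsWithin_le_nhds
  refine tendsto_nhds_unique hlim (hlim'.congr' ?_)
  filter_upwards [hball] with r hr
  refine (integral_log_norm_circleMap_sub_mul_sin_sq_of_one_lt ?_).symm
  rw [norm_mul, ← hw, Complex.norm_real, norm_eq_abs, abs_of_pos (by linarith), mul_one]
  exact hr.1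

/-- Integration against the semicircle density in the coordinate `s = 2 cos θ`. -/
lemma integral_mul_rho (g : ℝ → ℝ) :
    ∫ s in (-2 : ℝ)..2, g s * rho s =
      2 / π * ∫ θ in (0 : ℝ)..π, g (2 * cos θ) * sin θ ^ 2 := by
  have hd : ∀ θ : ℝ, HasDerivAt (fun θ ↦ 2 * cos θ) (-(2 * sin θ)) θ := fun θ ↦ by
    simpa using (hasDerivAt_cos θ).const_mul 2
  have hsub := intervalIntegral.integral_deriv_smul_comp_of_deriv_nonpos
    (a := 0) (b := π) (f := fun θ ↦ 2 * cos θ) (f' := fun θ ↦ -(2 * sin θ))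
    (g := fun s ↦ g s * rho s) (by fun_prop) (fun θ _ ↦ hd θ) (fun θ hθ ↦ by
      rw [min_eq_left pi_pos.le, max_eq_right pi_pos.le] at hθ
      linarith [sin_pos_of_mem_Ioo hθ])
  simp only [cos_zero, cos_pi, mul_one, mul_neg, Function.comp_apply, smul_eq_mul] at hsub
  rw [intervalIntegral.integral_symm, ← hsub, ← intervalIntegral.integral_const_mul,
    ← intervalIntegral.integral_neg]
  refine intervalIntegral.integral_congr fun θ hθ ↦ ?_
  rw [Set.uIcc_of_le pi_pos.le] at hθ
  have hsin := sin_nonneg_of_mem_Icc hθ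
  have hmem : 2 * cos θ ∈ Set.Icc (-2 : ℝ) 2 :=
    ⟨by linarith [neg_one_le_cos θ], by linarith [cos_le_one θ]⟩
  have hsqrt : √(4 - (2 * cos θ) ^ 2) = 2 * sin θ := by
    rw [show 4 - (2 * cos θ) ^ 2 = (2 * sin θ) ^ 2 by linear_combination -4 * sin_sq_add_cos_sq θ]
    exact sqrt_sq (by linarith)
  simp only [rho, if_pos hmem, hsqrt]
  field_simp

/-- The logarithmic potential of the semicircle law in the Joukowsky coordinate `y = w + w⁻¹`. -/
lemma integral_log_abs_sub_mul_rho {w : ℂ} (hw : 1 ≤ ‖w‖) {y : ℝ} (hy : (y : ℂ) = w + w⁻¹) :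
    ∫ s in (-2 : ℝ)..2, log |y - s| * rho s = log ‖w‖ + ((w ^ 2)⁻¹).re / 2 := by
  have hw0 : w ≠ 0 := norm_pos_iff.mp (one_pos.trans_le hw)
  have hwn : ‖w‖ ≠ 0 := norm_ne_zero_iff.mpr hw0
  have hfactor : ∀ θ : ℝ, |y - 2 * cos θ| * ‖w‖ =
      ‖circleMap 0 1 θ - w‖ * ‖circleMap 0 1 (2 * π - θ) - w‖ := fun θ ↦ by
    rw [← norm_eq_abs, ← Complex.norm_real, ← norm_mul, ← norm_mul]
    have hE : circleMap 0 1 (2 * π - θ) = (circleMap 0 1 θ)⁻¹ := by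
      rw [periodic_circleMap 0 1 |>.sub_eq']
      simp [circleMap, Complex.exp_neg]
    have hcos : ((2 * cos θ : ℝ) : ℂ) = circleMap 0 1 θ + (circleMap 0 1 θ)⁻¹ := by
      push_cast
      rw [Complex.two_cos]
      simp [circleMap, Complex.exp_neg]
    have hz : circleMap 0 1 θ ≠ 0 := circleMap_ne_center one_ne_zero
    rw [hE, Complex.ofReal_sub, hcos, hy]
    congr 1
    field_simp
    ring
  have hae : ∀ᵐ θ : ℝ, circleMap 0 1 θ ≠ w :=
    compl_mem_ae_iff.mpr
      (((Set.countable_singleton w).preimage_circleMap 0 one_ne_zero).measure_zero volume)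
  have hae' : ∀ᵐ θ : ℝ, circleMap 0 1 (2 * π - θ) ≠ w :=
    (Measure.measurePreserving_sub_left volume (2 * π)).quasiMeasurePreserving.ae hae
  have hlog : ∀ᵐ θ : ℝ, θ ∈ Set.uIoc 0 π → log |y - 2 * cos θ| * sin θ ^ 2 =
      log ‖circleMap 0 1 θ - w‖ * sin θ ^ 2
        + log ‖circleMap 0 1 (2 * π - θ) - w‖ * sin (2 * π - θ) ^ 2
        - log ‖w‖ * sin θ ^ 2 := by
    filter_upwards [hae, hae'] with θ h1 h2 _
    have n1 := norm_ne_zero_iff.mpr (sub_ne_zero.mpr h1)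
    have n2 := norm_ne_zero_iff.mpr (sub_ne_zero.mpr h2)
    have h := hfactor θ
    have n3 : |y - 2 * cos θ| ≠ 0 := fun h0 ↦ by
      rw [h0, zero_mul] at h
      exact mul_ne_zero n1 n2 h.symm
    have hl := congrArg log h
    rw [log_mul n3 hwn, log_mul n1 n2] at hl
    rw [sin_two_pi_sub]
    linear_combination sin θ ^ 2 * hl
  have hint : ∀ a b : ℝ, IntervalIntegrable
      (fun θ ↦ log ‖circleMap 0 1 θ - w‖ * sin θ ^ 2) volume a b := fun a b ↦
    (intervalIntegrable_log_norm_circleMap_sub w a b).mul_continuousOn (by fun_prop)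
  have hint' : IntervalIntegrable
      (fun θ ↦ log ‖circleMap 0 1 (2 * π - θ) - w‖ * sin (2 * π - θ) ^ 2) volume 0 π := by
    simpa using (hint (2 * π - 0) (2 * π - π)).comp_sub_left (2 * π)
  rw [integral_mul_rho fun s ↦ log |y - s|, intervalIntegral.integral_congr_ae hlog,
    intervalIntegral.integral_sub ((hint 0 π).add hint')
      (Continuous.intervalIntegrable (by fun_prop) _ _),
    intervalIntegral.integral_add (hint 0 π) hint',
    intervalIntegral.integral_comp_sub_left
      (fun θ ↦ log ‖circleMap 0 1 θ - w‖ * sin θ ^ 2) (2 * π),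
    show 2 * π - π = π by ring, sub_zero,
    intervalIntegral.integral_add_adjacent_intervals (hint _ _) (hint _ _),
    integral_log_norm_circleMap_sub_mul_sin_sq hw, intervalIntegral.integral_const_mul,
    integral_sin_sq]
  simp only [sin_zero, sin_pi, zero_mul]
  field_simp
  ring

/-- For real `|w| > 1` the effective potential at `w + w⁻¹` lies below its value on the support. -/
lemma effective_potential_lt {w : ℝ} (hw : 1 < |w|) :
    2 * (∫ s in (-2 : ℝ)..2, log |(w + w⁻¹) - s| * rho s) - (w + w⁻¹) ^ 2 / 2 < -1 := by
  have hpos : 0 < |w| := one_pos.trans hw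
  have hw0 : w ≠ 0 := abs_pos.mp hpos
  rw [integral_log_abs_sub_mul_rho (w := w) (by simpa using hw.le) (by push_cast; rfl)]
  have hsinh := self_lt_sinh_iff.mpr (show 0 < log (w ^ 2) from log_pos (by
    rw [← sq_abs]; exact one_lt_pow₀ hw two_ne_zero))
  rw [sinh_log (by positivity), log_pow, ← log_abs] at hsinh
  have hre : ((((w : ℂ)) ^ 2)⁻¹).re = (w ^ 2)⁻¹ := by
    rw [← Complex.ofReal_pow, ← Complex.ofReal_inv, Complex.ofReal_re]
  have hsq : (w + w⁻¹) ^ 2 = w ^ 2 + 2 + (w ^ 2)⁻¹ := by field_simp; ring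
  rw [hre, hsq, Complex.norm_real, norm_eq_abs]
  push_cast at hsinh
  linarith

/-- `ρ` is a probability density, and there is a constant `l` such that
`2∫ log|y-s| ρ(s) ds − y²/2 = l` on `[-2,2]` and `< l` off `[-2,2]`. -/
theorem stmt5 :
    (∫ s in (-2 : ℝ)..2, rho s) = 1 ∧
    ∃ l : ℝ,
      (∀ y ∈ Set.Icc (-2 : ℝ) 2,
        2 * (∫ s in (-2 : ℝ)..2, Real.log |y - s| * rho s) - y ^ 2 / 2 = l) ∧
      (∀ y : ℝ, y ∉ Set.Icc (-2 : ℝ) 2 →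
        2 * (∫ s in (-2 : ℝ)..2, Real.log |y - s| * rho s) - y ^ 2 / 2 < l) := by
  refine ⟨?_, -1, fun y hy ↦ ?_, fun y hy ↦ ?_⟩
  · have h := integral_mul_rho fun _ ↦ 1
    simp only [one_mul, integral_sin_sq, sin_zero, sin_pi, zero_mul] at h
    rw [h]
    field_simp
    ring
  · set φ := arccos (y / 2)
    have hcos : cos φ = y / 2 := cos_arccos (by linarith [hy.1]) (by linarith [hy.2])
    have hnorm : ‖Complex.exp (φ * Complex.I)‖ = 1 := Complex.norm_exp_ofReal_mul_I φ
    have hyw : (y : ℂ) = Complex.exp (φ * Complex.I) + (Complex.exp (φ * Complex.I))⁻¹ := by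
      rw [← Complex.exp_neg, ← neg_mul, ← Complex.two_cos, ← Complex.ofReal_cos, hcos]
      push_cast
      ring
    have hre : ((Complex.exp (φ * Complex.I) ^ 2)⁻¹).re = cos (2 * φ) := by
      rw [← Complex.exp_nat_mul, ← Complex.exp_neg,
        show -(((2 : ℕ) : ℂ) * (φ * Complex.I)) = ((-(2 * φ) : ℝ) : ℂ) * Complex.I by
          push_cast; ring, Complex.exp_ofReal_mul_I_re, cos_neg]
    rw [integral_log_abs_sub_mul_rho hnorm.ge hyw, hnorm, log_one, hre, cos_two_mul, hcos]
    ring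
  · have hy2 : 2 < |y| := by
      by_contra! h
      exact hy (abs_le.mp h)
    obtain ⟨w, hw, rfl⟩ : ∃ w : ℝ, 1 < |w| ∧ w + w⁻¹ = y := by
      have hD : 0 < y ^ 2 - 4 := by rw [← sq_abs]; nlinarith
      have hsq := sq_sqrt hD.le
      have hs := sqrt_pos.mpr hD
      rcases lt_abs.mp hy2 with h | h
      · refine ⟨(y + √(y ^ 2 - 4)) / 2, lt_abs.mpr (Or.inl (by linarith)), ?_⟩
        have : y + √(y ^ 2 - 4) ≠ 0 := by linarith
        field_simp
        linear_combination hsq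
      · refine ⟨(y - √(y ^ 2 - 4)) / 2, lt_abs.mpr (Or.inr (by linarith)), ?_⟩
        have : y - √(y ^ 2 - 4) ≠ 0 := by linarith
        field_simp
        linear_combination hsq
    exact effective_potential_lt hw
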